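/- arXiv:2309.06427 — 2 statements merged into one kernel-verified Lean document; each statement's English description precedes it below -/
import Mathlib

section
/- Let Ψ be a stair matrix (a block tridiagonal matrix whose off-diagonal blocks are nonzero only in block rows of a fixed parity) all of whose diagonal blocks are invertible, and let D be its block-diagonal part. Then Ψ⁻¹ = D⁻¹ * (2 • D − Ψ) * D⁻¹. -/
open Matrix

namespace StairPrecond

/-- Real matrices indexed as n×n arrays of m×m blocks. -/
abbrev Mat (n m : ℕ) := Matrix (Fin n × Fin m) (Fin n × Fin m) ℝ

/-- Vectors compatible with `Mat n m`. -/
abbrev Vec (n m : ℕ) := Fin n × Fin m → ℝ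

/-- The (i,j)-block of a block matrix. -/
def blockOf {n m : ℕ} (M : Mat n m) (i j : Fin n) : Matrix (Fin m) (Fin m) ℝ :=
  fun a b => M (i, a) (j, b)

/-- A matrix is block tridiagonal if its (i,j)-block vanishes whenever |i - j| > 1. -/
def IsBlockTridiag {n m : ℕ} (M : Mat n m) : Prop :=
  ∀ i j : Fin n, (i.val + 1 < j.val ∨ j.val + 1 < i.val) → blockOf M i j = 0

/-- The block-diagonal part `D` of a matrix: keep only the diagonal blocks. -/
def blockDiagPart {n m : ℕ} (M : Mat n m) : Mat n m :=
  fun p q => if p.1 = q.1 then M p q else 0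

/-- The left stair Ψl: diagonal blocks everywhere, off-diagonal blocks only in
block rows of odd index (0-indexed). -/
def stairL {n m : ℕ} (M : Mat n m) : Mat n m :=
  fun p q =>
    if p.1 = q.1 ∨ (Odd p.1.val ∧ (p.1.val = q.1.val + 1 ∨ q.1.val = p.1.val + 1)) then M p q
    else 0

/-- The right stair Ψr: diagonal blocks everywhere, off-diagonal blocks only in
block rows of even index (0-indexed). -/
def stairR {n m : ℕ} (M : Mat n m) : Mat n m :=
  fun p q =>
    if p.1 = q.1 ∨ (Even p.1.val ∧ (p.1.val = q.1.val + 1 ∨ q.1.val = p.1.val + 1)) then M p q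
    else 0

/-- Pl = Ψl − S. -/
def Pl {n m : ℕ} (S : Mat n m) : Mat n m := stairL S - S

/-- Pr = Ψr − S. -/
def Pr {n m : ℕ} (S : Mat n m) : Mat n m := stairR S - S

/-- The additive stair preconditioner Φadd⁻¹ = (1/2) • (Ψl⁻¹ + Ψr⁻¹). -/
noncomputable def Phiadd {n m : ℕ} (S : Mat n m) : Mat n m :=
  (1 / 2 : ℝ) • ((stairL S)⁻¹ + (stairR S)⁻¹)

/-- The symmetric stair preconditioner Φsym⁻¹ = Ψl⁻¹ + Ψr⁻¹ − D⁻¹. -/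
noncomputable def Phisym {n m : ℕ} (S : Mat n m) : Mat n m :=
  (stairL S)⁻¹ + (stairR S)⁻¹ - (blockDiagPart S)⁻¹

/-- All diagonal blocks are invertible m×m matrices. -/
def DiagBlocksInvertible {n m : ℕ} (M : Mat n m) : Prop :=
  ∀ i : Fin n, IsUnit (blockOf M i i)

/-- v_e : the part of v supported on blocks of odd index (0-indexed). -/
def vE {n m : ℕ} (v : Vec n m) : Vec n m := fun p => if Odd p.1.val then v p else 0

/-- v_o : the part of v supported on blocks of even index (0-indexed). -/
def vO {n m : ℕ} (v : Vec n m) : Vec n m := fun p => if Even p.1.val then v p else 0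

/-- A stair matrix: block tridiagonal, with off-diagonal blocks nonzero only in
block rows of a fixed parity (a left stair has them only in odd-indexed rows,
a right stair only in even-indexed rows, 0-indexed). -/
def IsStairMatrix {n m : ℕ} (Ψ : Mat n m) : Prop :=
  IsBlockTridiag Ψ ∧
    ((∀ i j : Fin n, i ≠ j → Even i.val → blockOf Ψ i j = 0) ∨
     (∀ i j : Fin n, i ≠ j → Odd i.val → blockOf Ψ i j = 0))

/-- The block-diagonal matrix whose diagonal blocks are the inverses of those of `M`. -/
noncomputable def blockDiagInv {n m : ℕ} (M : Mat n m) : Mat n m :=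
  fun p q => if p.1 = q.1 then (blockOf M p.1 p.1)⁻¹ p.2 q.2 else 0

theorem blockDiagPart_mul_blockDiagInv {n m : ℕ} {M : Mat n m} (hM : DiagBlocksInvertible M) :
    blockDiagPart M * blockDiagInv M = 1 := by
  ext ⟨i, a⟩ ⟨j, b⟩
  have hblock : blockOf M i i * (blockOf M i i)⁻¹ = 1 :=
    Matrix.mul_nonsing_inv _ ((Matrix.isUnit_iff_isUnit_det _).mp (hM i))
  rw [Matrix.mul_apply, Fintype.sum_prod_type, Finset.sum_eq_single i]
  · by_cases hij : i = j
    · subst hij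
      have hab := congrFun (congrFun hblock a) b
      rw [Matrix.mul_apply] at hab
      simpa [blockDiagPart, blockDiagInv, blockOf, Matrix.one_apply] using hab
    · simp [blockDiagInv, hij]
  · intro k _ hk
    simp [blockDiagPart, hk.symm]
  · simp

/-- The off-diagonal part of a stair matrix vanishes in the block rows it links to, so its
product with itself through a block-diagonal matrix is zero. -/
theorem IsStairMatrix.offDiag_mul_blockDiagInv_mul_offDiag {n m : ℕ} {M : Mat n m}
    (hM : IsStairMatrix M) :
    (blockDiagPart M - M) * blockDiagInv M * (blockDiagPart M - M) = 0 := by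
  obtain ⟨htri, hpar⟩ := hM
  have hzero : ∀ p q r s : Fin n × Fin m, q.1 = r.1 →
      (blockDiagPart M - M) p q = 0 ∨ (blockDiagPart M - M) r s = 0 := by
    rintro ⟨i, a⟩ ⟨j, b⟩ ⟨k, c⟩ ⟨l, d⟩ hjk
    obtain rfl : j = k := hjk
    by_cases hij : i = j
    · simp [blockDiagPart, hij]
    by_cases hjl : j = l
    · simp [blockDiagPart, hjl]
    have hentry {x y : Fin n} (e f : Fin m) (h : blockOf M x y = 0) : M (x, e) (y, f) = 0 :=
      congrFun (congrFun h e) f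
    simp only [Matrix.sub_apply, blockDiagPart, hij, hjl, if_false, zero_sub, neg_eq_zero]
    by_cases hfar : i.val + 1 < j.val ∨ j.val + 1 < i.val
    · exact Or.inl (hentry a b (htri i j hfar))
    have hne : i.val ≠ j.val := fun h => hij (Fin.ext h)
    rcases hpar with h | h
    · rcases Nat.even_or_odd i.val with hi | hi
      · exact Or.inl (hentry a b (h i j hij hi))
      · exact Or.inr (hentry c d (h j l hjl (by grind)))
    · rcases Nat.even_or_odd i.val with hi | hi
      · exact Or.inr (hentry c d (h j l hjl (by grind)))
      · exact Or.inl (hentry a b (h i j hij hi))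
  ext p s
  simp only [Matrix.mul_apply, Finset.sum_mul, Matrix.zero_apply]
  refine Finset.sum_eq_zero fun r _ => Finset.sum_eq_zero fun q _ => ?_
  by_cases hqr : q.1 = r.1
  · rcases hzero p q r s hqr with h | h <;> simp [h]
  · simp [blockDiagInv, hqr]

/-- The inverse of a stair matrix with invertible diagonal blocks satisfies
Ψ⁻¹ = D⁻¹ * (2 • D − Ψ) * D⁻¹. -/
theorem stair_inverse_formula {n m : ℕ} (hn : 0 < n) (hm : 0 < m)
    (Psi : Mat n m) (hstair : IsStairMatrix Psi) (hdiag : DiagBlocksInvertible Psi) :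
    Psi⁻¹ = (blockDiagPart Psi)⁻¹ * ((2 : ℝ) • blockDiagPart Psi - Psi) *
      (blockDiagPart Psi)⁻¹ := by
  have hDE := blockDiagPart_mul_blockDiagInv hdiag
  have hNEN := hstair.offDiag_mul_blockDiagInv_mul_offDiag
  rw [Matrix.inv_eq_right_inv hDE]
  apply Matrix.inv_eq_right_inv
  generalize blockDiagPart Psi = D at *
  generalize blockDiagInv Psi = E at *
  have hPsi : Psi = D - (D - Psi) := by abel
  have hRight : (2 : ℝ) • D - Psi = D + (D - Psi) := by rw [two_smul]; abel
  rw [hRight]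
  generalize D - Psi = N at *
  subst hPsi
  calc (D - N) * (E * (D + N) * E)
      = D * E * (D * E) + D * E * N * E - N * E * (D * E) - N * E * N * E := by noncomm_ring
    _ = 1 := by rw [hDE, hNEN]; noncomm_ring

end StairPrecond
end

section
/- Let S be a symmetric block tridiagonal matrix all of whose diagonal blocks are invertible, with stair splittings S = Ψl − Pl = Ψr − Pr and block-diagonal part D. Then D⁻¹ * Pr = (Ψl⁻¹ − D⁻¹) * Ψl and Ψr⁻¹ − D⁻¹ = D⁻¹ * Pl * D⁻¹. -/
open Matrix

namespace StairPrecond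

theorem isUnit_blockDiagPart {n m : ℕ} {S : Mat n m} (hdiag : DiagBlocksInvertible S) :
    IsUnit (blockDiagPart S) := by
  have h : blockDiagPart S =
      (blockDiagonal fun i => blockOf S i i).submatrix
        (Equiv.prodComm (Fin n) (Fin m)) (Equiv.prodComm (Fin n) (Fin m)) := by
    ext ⟨i, a⟩ ⟨j, b⟩
    by_cases hij : i = j
    · subst hij
      simp [blockDiagPart, blockOf, blockDiagonal_apply]
    · simp [blockDiagPart, blockDiagonal_apply, hij]
  rw [h, isUnit_submatrix_equiv, isUnit_iff_isUnit_det, det_blockDiagonal]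
  exact (IsUnit.prod_univ_iff (f := fun i => (blockOf S i i).det)).2 fun i =>
    (isUnit_iff_isUnit_det _).1 (hdiag i)

/-- If `N` is supported on the block rows satisfying `p` and on the block columns not
satisfying `p`, then `D⁻¹ - D⁻¹ * N * D⁻¹` is a right inverse of `D + N`. -/
theorem blockDiagPart_add_mul_eq_one {n m : ℕ} {S N : Mat n m} (hdiag : DiagBlocksInvertible S)
    (p : Fin n → Prop) (hrow : ∀ x y, ¬ p x.1 → N x y = 0) (hcol : ∀ x y, p y.1 → N x y = 0) :
    (blockDiagPart S + N) *
      ((blockDiagPart S)⁻¹ - (blockDiagPart S)⁻¹ * N * (blockDiagPart S)⁻¹) = 1 := by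
  classical
  have hD := (isUnit_iff_isUnit_det _).1 (isUnit_blockDiagPart hdiag)
  set D := blockDiagPart S with hD_def
  let E : Mat n m := diagonal fun x => if p x.1 then 1 else 0
  have hEN : E * N = N := by
    ext x y
    by_cases hx : p x.1 <;> simp [E, diagonal_mul, hx, hrow]
  have hNE : N * E = 0 := by
    ext x y
    by_cases hy : p y.1 <;> simp [E, mul_diagonal, hy, hcol]
  have hED : E * D = D * E := by
    ext x y
    by_cases hxy : x.1 = y.1 <;>
      simp [E, hD_def, diagonal_mul, mul_diagonal, blockDiagPart, hxy]
  have hEDinv : D⁻¹ * E = E * D⁻¹ := by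
    calc D⁻¹ * E = D⁻¹ * (E * D) * D⁻¹ := by
          rw [mul_assoc, mul_assoc, mul_nonsing_inv _ hD, mul_one]
      _ = E * D⁻¹ := by rw [hED, ← mul_assoc, nonsing_inv_mul _ hD, one_mul]
  have hNDN : N * (D⁻¹ * N) = 0 := by
    calc N * (D⁻¹ * N) = N * (D⁻¹ * E * N) := by rw [mul_assoc D⁻¹, hEN]
      _ = N * E * (D⁻¹ * N) := by rw [hEDinv]; simp only [mul_assoc]
      _ = 0 := by rw [hNE, zero_mul]
  rw [add_mul, mul_sub, mul_sub, ← mul_assoc N, hNDN, mul_assoc D⁻¹ N, ← mul_assoc D D⁻¹,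
    mul_nonsing_inv _ hD, one_mul, zero_mul]
  abel

theorem stairL_mul_eq_one {n m : ℕ} {S : Mat n m}
    (hdiag : DiagBlocksInvertible S) :
    stairL S * ((blockDiagPart S)⁻¹ -
      (blockDiagPart S)⁻¹ * (stairL S - blockDiagPart S) * (blockDiagPart S)⁻¹) = 1 := by
  have h := blockDiagPart_add_mul_eq_one (N := stairL S - blockDiagPart S) hdiag
    (fun i => Odd i.val) ?_ ?_
  · rwa [add_sub_cancel] at h
  all_goals
    intro x y hp
    simp only [Matrix.sub_apply, stairL, blockDiagPart, Fin.ext_iff]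
    grind

theorem stairR_mul_eq_one {n m : ℕ} {S : Mat n m}
    (hdiag : DiagBlocksInvertible S) :
    stairR S * ((blockDiagPart S)⁻¹ -
      (blockDiagPart S)⁻¹ * (stairR S - blockDiagPart S) * (blockDiagPart S)⁻¹) = 1 := by
  have h := blockDiagPart_add_mul_eq_one (N := stairR S - blockDiagPart S) hdiag
    (fun i => Even i.val) ?_ ?_
  · rwa [add_sub_cancel] at h
  all_goals
    intro x y hp
    simp only [Matrix.sub_apply, stairR, blockDiagPart, Fin.ext_iff]
    grind

theorem stairL_add_stairR {n m : ℕ} {S : Mat n m} (htri : IsBlockTridiag S) :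
    stairL S + stairR S = S + blockDiagPart S := by
  ext x y
  have h : (x.1.val + 1 < y.1.val ∨ y.1.val + 1 < x.1.val) → S x y = 0 := fun hxy =>
    congrFun (congrFun (htri x.1 y.1 hxy) x.2) y.2
  have hparity := Nat.even_or_odd x.1.val
  simp only [Matrix.add_apply, stairL, stairR, blockDiagPart, Fin.ext_iff]
  grind

/-- Identities relating the stair splittings and the block-diagonal part:
D⁻¹ * Pr = (Ψl⁻¹ − D⁻¹) * Ψl and Ψr⁻¹ − D⁻¹ = D⁻¹ * Pl * D⁻¹. -/
theorem stair_splitting_identities {n m : ℕ} (hn : 0 < n) (hm : 0 < m)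
    (S : Mat n m) (hsymm : S.IsSymm) (htri : IsBlockTridiag S)
    (hdiag : DiagBlocksInvertible S) :
    (blockDiagPart S)⁻¹ * Pr S = ((stairL S)⁻¹ - (blockDiagPart S)⁻¹) * stairL S ∧
      (stairR S)⁻¹ - (blockDiagPart S)⁻¹ =
        (blockDiagPart S)⁻¹ * Pl S * (blockDiagPart S)⁻¹ := by
  have hD := (isUnit_iff_isUnit_det _).1 (isUnit_blockDiagPart hdiag)
  have hsum := stairL_add_stairR htri
  have hPr : Pr S = blockDiagPart S - stairL S := by
    rw [Pr, sub_eq_sub_iff_add_eq_add, add_comm, hsum, add_comm]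
  have hPl : Pl S = blockDiagPart S - stairR S := by
    rw [Pl, sub_eq_sub_iff_add_eq_add, hsum, add_comm]
  constructor
  · have hL := isUnit_det_of_right_inverse (stairL_mul_eq_one hdiag)
    rw [hPr, mul_sub, sub_mul, nonsing_inv_mul _ hD, nonsing_inv_mul _ hL]
  · rw [inv_eq_right_inv (stairR_mul_eq_one hdiag), hPl, ← neg_sub (stairR S), mul_neg, neg_mul]
    abel

end StairPrecond
end
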